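/- Let G = (V = {1,…,n}, w) be a connected loopless weighted graph, let γ = vol_max/vol_min where vol_max and vol_min are the maximum and minimum vertex volumes, and let h_G and h̃_G be the Cheeger and fractional Cheeger constants of G. Then for every ε with 0 < ε < 1 one has h̃_G ≥ (1 − 2γ/(ε²·n))·(1 − ε)·h_G. -/

import Mathlib

open Finset

noncomputable section

/-- A weighted graph on the vertex set `{1,…,n}` (modelled as `Fin n`):
a symmetric weight function with values in `[0,1]`. -/
structure WGraph (n : ℕ) where
  w : Fin n → Fin n → ℝ
  symm : ∀ u v, w u v = w v u
  nonneg : ∀ u v, 0 ≤ w u v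
  le_one : ∀ u v, w u v ≤ 1

namespace WGraph

variable {n : ℕ}

/-- The volume of a vertex: `vol(u) = Σ_v w(u,v)`. -/
def vol (Gr : WGraph n) (u : Fin n) : ℝ := ∑ v, Gr.w u v

/-- The total volume `vol(G) = Σ_u vol(u)`. -/
def volG (Gr : WGraph n) : ℝ := ∑ u, Gr.vol u

/-- The total weight of edges crossing the cut `(A, Aᶜ)`. -/
def cut (Gr : WGraph n) (A : Finset (Fin n)) : ℝ := ∑ u ∈ A, ∑ v ∈ Aᶜ, Gr.w u v

/-- Connectedness: every cut into two nonempty parts has positive weight. -/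
def Connected (Gr : WGraph n) : Prop :=
  ∀ A : Finset (Fin n), A.Nonempty → A ≠ Finset.univ → 0 < Gr.cut A

/-- Looplessness: `w(u,u) = 0` for all `u`. -/
def Loopless (Gr : WGraph n) : Prop := ∀ u, Gr.w u u = 0

/-- The Cheeger constant of a weighted graph. -/
def cheeger (Gr : WGraph n) : ℝ :=
  sInf {r : ℝ | ∃ A : Finset (Fin n), A.Nonempty ∧ A ≠ Finset.univ ∧
    r = Gr.cut A / min (∑ u ∈ A, Gr.vol u) (∑ v ∈ Aᶜ, Gr.vol v)}

/-- A fractional partition of the vertex set: `ρ : V → [0,1]` (with `η = 1 − ρ`). -/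
def IsFracPartition (ρ : Fin n → ℝ) : Prop := ∀ u, 0 ≤ ρ u ∧ ρ u ≤ 1

/-- The quantity `h̃(G; ρ, 1−ρ)` from the definition of the fractional Cheeger
constant. -/
def fracH (Gr : WGraph n) (ρ : Fin n → ℝ) : ℝ :=
  (∑ u, ∑ v, ρ u * (1 - ρ v) * Gr.w u v) /
    min (∑ u, ρ u * Gr.vol u) (∑ v, (1 - ρ v) * Gr.vol v)

/-- The fractional Cheeger constant: the infimum of `h̃(G; ρ, η)` over all fractional
partitions `(ρ, η = 1 − ρ)` with `Σ ρ(u)vol(u) > 0` and `Σ η(v)vol(v) > 0`. -/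
def fracCheeger (Gr : WGraph n) : ℝ :=
  sInf {r : ℝ | ∃ ρ : Fin n → ℝ, IsFracPartition ρ ∧
    0 < ∑ u, ρ u * Gr.vol u ∧ 0 < ∑ v, (1 - ρ v) * Gr.vol v ∧ r = Gr.fracH ρ}

end WGraph

/-- The probability of `A` when every `u` is put into the set independently with
probability `ρ u`. -/
def bernoulliWeight {α : Type*} [Fintype α] [DecidableEq α] (ρ : α → ℝ) (A : Finset α) : ℝ :=
  (∏ u ∈ A, ρ u) * ∏ u ∈ Aᶜ, (1 - ρ u)

section Bernoulli

variable {α : Type*} [Fintype α] [DecidableEq α] {ρ : α → ℝ}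

theorem bernoulliWeight_nonneg (hρ : ∀ u, 0 ≤ ρ u ∧ ρ u ≤ 1) (A : Finset α) :
    0 ≤ bernoulliWeight ρ A :=
  mul_nonneg (prod_nonneg fun u _ => (hρ u).1)
    (prod_nonneg fun u _ => sub_nonneg.2 (hρ u).2)

theorem sum_bernoulliWeight_subset (ρ : α → ℝ) (S : Finset α) :
    ∑ A, bernoulliWeight ρ A * (if S ⊆ A then 1 else 0) = ∏ u ∈ S, ρ u := by
  have h := Finset.prod_add ρ (fun u => if u ∈ S then 0 else 1 - ρ u) univ
  have hl : ∏ u, (ρ u + if u ∈ S then 0 else 1 - ρ u) = ∏ u ∈ S, ρ u := by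
    rw [← Finset.prod_subset (subset_univ S)]
    · exact prod_congr rfl fun u hu => by simp [hu]
    · intro u _ hu
      simp [hu]
  rw [← hl, h, powerset_univ]
  refine sum_congr rfl fun A _ => ?_
  rw [bernoulliWeight, mul_assoc, ← compl_eq_univ_sdiff]
  congr 1
  by_cases hS : S ⊆ A
  · rw [if_pos hS, mul_one]
    refine prod_congr rfl fun u hu => ?_
    rw [if_neg fun h => mem_compl.1 hu (hS h)]
  · rw [if_neg hS, mul_zero]
    obtain ⟨u, huS, huA⟩ := not_subset.1 hS
    symm
    apply prod_eq_zero (mem_compl.2 huA)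
    rw [if_pos huS]

theorem sum_bernoulliWeight (ρ : α → ℝ) : ∑ A, bernoulliWeight ρ A = 1 := by
  simpa using sum_bernoulliWeight_subset ρ ∅

/-- The expectation of a linear functional of the random set. -/
theorem sum_bernoulliWeight_linear (ρ c : α → ℝ) :
    ∑ A, bernoulliWeight ρ A * ∑ u ∈ A, c u = ∑ u, ρ u * c u := by
  have h (A : Finset α) : bernoulliWeight ρ A * ∑ u ∈ A, c u =
      ∑ u, bernoulliWeight ρ A * (if {u} ⊆ A then 1 else 0) * c u := by
    simp [mul_sum]
  simp_rw [h]
  rw [sum_comm]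
  refine sum_congr rfl fun u _ => ?_
  rw [← sum_mul, sum_bernoulliWeight_subset, prod_singleton]

/-- The expectation of a quadratic functional of the random set. -/
theorem sum_bernoulliWeight_quadratic (ρ : α → ℝ) (c : α → α → ℝ) :
    ∑ A, bernoulliWeight ρ A * ∑ u ∈ A, ∑ v ∈ A, c u v =
      ∑ u, ∑ v, (if u = v then ρ u else ρ u * ρ v) * c u v := by
  have h (A : Finset α) : bernoulliWeight ρ A * ∑ u ∈ A, ∑ v ∈ A, c u v =
      ∑ u, ∑ v, bernoulliWeight ρ A * (if {u, v} ⊆ A then 1 else 0) * c u v := by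
    simp [mul_sum, insert_subset_iff, ite_and]
  simp_rw [h]
  rw [sum_comm]
  refine sum_congr rfl fun u _ => ?_
  rw [sum_comm]
  refine sum_congr rfl fun v _ => ?_
  rw [← sum_mul, sum_bernoulliWeight_subset]
  by_cases huv : u = v
  · simp [huv]
  · simp [huv, prod_pair huv]

theorem sum_bernoulliWeight_sq (ρ c : α → ℝ) :
    ∑ A, bernoulliWeight ρ A * (∑ u ∈ A, c u) ^ 2 =
      (∑ u, ρ u * c u) ^ 2 + ∑ u, ρ u * (1 - ρ u) * c u ^ 2 := by
  simp_rw [sq (∑ u ∈ _, c u), sum_mul_sum]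
  rw [sum_bernoulliWeight_quadratic, sq, sum_mul_sum, ← sum_add_distrib]
  refine sum_congr rfl fun u _ => ?_
  have h (v : α) : (if u = v then ρ u else ρ u * ρ v) * (c u * c v) =
      ρ u * c u * (ρ v * c v) + if u = v then ρ u * (1 - ρ u) * c u ^ 2 else 0 := by
    split_ifs with huv
    · subst huv; ring
    · ring
  simp_rw [h, sum_add_distrib]
  simp

theorem sum_bernoulliWeight_sq_le (hρ : ∀ u, 0 ≤ ρ u ∧ ρ u ≤ 1) {c : α → ℝ} {M : ℝ}
    (hc : ∀ u, 0 ≤ c u) (hM : ∀ u, c u ≤ M) :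
    ∑ A, bernoulliWeight ρ A * (∑ u ∈ A, c u) ^ 2 ≤
      (∑ u, ρ u * c u) ^ 2 + M * ∑ u, ρ u * c u := by
  rw [sum_bernoulliWeight_sq, mul_sum]
  refine add_le_add le_rfl (sum_le_sum fun u _ => ?_)
  have h₁ : 0 ≤ ρ u * c u := mul_nonneg (hρ u).1 (hc u)
  nlinarith [mul_nonneg h₁ (sub_nonneg.2 (hM u)),
    mul_nonneg (mul_nonneg h₁ (hc u)) (hρ u).1]

/-- The expected value of a quadratic polynomial in the weight of the random set bounds from below
the expectation of anything that dominates it pointwise. -/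
theorem le_sum_bernoulliWeight (hρ : ∀ u, 0 ≤ ρ u ∧ ρ u ≤ 1) {c : α → ℝ} {M : ℝ}
    (hc : ∀ u, 0 ≤ c u) (hM : ∀ u, c u ≤ M) {f : Finset α → ℝ} {a b d : ℝ} (hd : 0 ≤ d)
    (hf : ∀ A, a + b * ∑ u ∈ A, c u - d * (∑ u ∈ A, c u) ^ 2 ≤ f A) :
    a + b * (∑ u, ρ u * c u) - d * ((∑ u, ρ u * c u) ^ 2 + M * ∑ u, ρ u * c u) ≤
      ∑ A, bernoulliWeight ρ A * f A := by
  have h₁ : ∑ A, bernoulliWeight ρ A * (a + b * ∑ u ∈ A, c u - d * (∑ u ∈ A, c u) ^ 2) =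
      a * ∑ A, bernoulliWeight ρ A + b * ∑ A, bernoulliWeight ρ A * ∑ u ∈ A, c u -
        d * ∑ A, bernoulliWeight ρ A * (∑ u ∈ A, c u) ^ 2 := by
    simp_rw [mul_sum (s := univ), ← sum_add_distrib, ← sum_sub_distrib]
    exact sum_congr rfl fun A _ => by ring
  rw [sum_bernoulliWeight, sum_bernoulliWeight_linear, mul_one] at h₁
  have h₂ := mul_le_mul_of_nonneg_left (sum_bernoulliWeight_sq_le hρ hc hM) hd
  have h₃ := sum_le_sum fun A (_ : A ∈ univ) =>
    mul_le_mul_of_nonneg_left (hf A) (bernoulliWeight_nonneg hρ A)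
  linarith

/-- The smaller side of a random bipartition is in expectation not much smaller than the smaller
of the expected sides. -/
theorem le_sum_bernoulliWeight_min (hρ : ∀ u, 0 ≤ ρ u ∧ ρ u ≤ 1) {c : α → ℝ} {κ ε : ℝ}
    (hc : ∀ u, 0 ≤ c u) (hT : 0 < ∑ u, c u) (hκ : 0 ≤ κ) (hM : ∀ u, c u ≤ κ * ∑ u, c u)
    (hε0 : 0 < ε) (hε1 : ε < 1) (hκε : 2 * κ < ε ^ 2)
    (hhalf : 2 * ∑ u, ρ u * c u ≤ ∑ u, c u) :
    (1 - 2 * κ / ε ^ 2) * (1 - ε) * (∑ u, ρ u * c u) ≤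
      ∑ A, bernoulliWeight ρ A * min (∑ u ∈ A, c u) (∑ u ∈ Aᶜ, c u) := by
  have hcompl (A : Finset α) : ∑ u ∈ Aᶜ, c u = ∑ u, c u - ∑ u ∈ A, c u := by
    rw [← sum_add_sum_compl A c]; ring
  simp_rw [hcompl]
  have hm : 0 ≤ ∑ u, ρ u * c u := sum_nonneg fun u _ => mul_nonneg (hρ u).1 (hc u)
  have key {a b d : ℝ} (hd : 0 ≤ d) (hf : ∀ x, a + b * x - d * x ^ 2 ≤ min x (∑ u, c u - x)) :=
    le_sum_bernoulliWeight hρ hc hM (a := a) (b := b) (d := d) hd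
      (f := fun A => min (∑ u ∈ A, c u) (∑ u, c u - ∑ u ∈ A, c u)) (fun A => hf _)
  generalize (∑ A, bernoulliWeight ρ A * min (∑ u ∈ A, c u) (∑ u, c u - ∑ u ∈ A, c u)) = E at *
  generalize ∑ u, ρ u * c u = m at *
  generalize ∑ u, c u = T at *
  set q := 2 * κ / ε ^ 2 with hq
  have hκq : κ = q * ε ^ 2 / 2 := by rw [hq]; field_simp
  have hq0 : 0 ≤ q := by positivity
  have hq1 : q < 1 := by rw [hq, div_lt_one (by positivity)]; exact hκε
  rcases le_total ε (1 / 2) with hε | hε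
  · obtain ⟨s, hs⟩ : ∃ s, s = T - m * (2 - ε) := ⟨_, rfl⟩
    have hsT : ε * T / 2 ≤ s := by nlinarith
    have hs0 : 0 < s := lt_of_lt_of_le (by positivity) hsT
    have h := key (a := -ε * m - m ^ 2 / s) (b := 1 + 2 * m / s) (d := 1 / s) (by positivity)
      (fun x => by
        have e : -ε * m - m ^ 2 / s + (1 + 2 * m / s) * x - 1 / s * x ^ 2 =
            x - ε * m - (x - m) ^ 2 / s := by ring
        have e₂ : T - x - (x - ε * m - (x - m) ^ 2 / s) = (s - (x - m)) ^ 2 / s := by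
          field_simp
          rw [hs]; ring
        have h₁ : 0 ≤ (x - m) ^ 2 / s := by positivity
        have h₂ : 0 ≤ (s - (x - m)) ^ 2 / s := by positivity
        have h₃ : 0 ≤ ε * m := by positivity
        rw [e]
        exact le_min (by linarith) (by linarith))
    have e : -ε * m - m ^ 2 / s + (1 + 2 * m / s) * m - 1 / s * (m ^ 2 + κ * T * m) =
        m * (1 - ε - κ * T / s) := by ring
    rw [e] at h
    refine le_trans ?_ h
    rw [mul_comm]
    refine mul_le_mul_of_nonneg_left ?_ hm
    have h₁ : κ * T / s ≤ q * ε := by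
      rw [div_le_iff₀ hs0, hκq]
      nlinarith [mul_le_mul_of_nonneg_left hsT (mul_nonneg hq0 hε0.le)]
    nlinarith
  · have h := key (a := 0) (b := 1) (d := 1 / T) (by positivity) (fun x => by
      have e₂ : T - x - (0 + 1 * x - 1 / T * x ^ 2) = (T - x) ^ 2 / T := by
        field_simp
        ring
      have h₁ : 0 ≤ 1 / T * x ^ 2 := by positivity
      have h₂ : 0 ≤ (T - x) ^ 2 / T := by positivity
      exact le_min (by linarith) (by linarith))
    have e : 0 + 1 * m - 1 / T * (m ^ 2 + κ * T * m) = m * (1 - κ - m / T) := by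
      field_simp
      ring
    rw [e] at h
    refine le_trans ?_ h
    rw [mul_comm]
    refine mul_le_mul_of_nonneg_left ?_ hm
    have h₁ : m / T ≤ 1 / 2 := by rw [div_le_iff₀ hT]; linarith
    rw [hκq]
    nlinarith [mul_nonneg hq0 (sub_nonneg.2 hε1.le), mul_nonneg (sub_nonneg.2 hq1.le)
      (sub_nonneg.2 hε), mul_nonneg hq0 (mul_nonneg hε0.le (sub_nonneg.2 hε1.le))]

end Bernoulli

namespace WGraph

variable {n : ℕ} (Gr : WGraph n)

theorem vol_nonneg (u : Fin n) : 0 ≤ Gr.vol u := sum_nonneg fun _ _ => Gr.nonneg _ _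

theorem cut_nonneg (A : Finset (Fin n)) : 0 ≤ Gr.cut A :=
  sum_nonneg fun _ _ => sum_nonneg fun _ _ => Gr.nonneg _ _

theorem cut_div_min_nonneg (A : Finset (Fin n)) :
    0 ≤ Gr.cut A / min (∑ u ∈ A, Gr.vol u) (∑ v ∈ Aᶜ, Gr.vol v) :=
  div_nonneg (Gr.cut_nonneg A) (le_min (sum_nonneg fun _ _ => Gr.vol_nonneg _)
    (sum_nonneg fun _ _ => Gr.vol_nonneg _))

theorem cheeger_nonneg : 0 ≤ Gr.cheeger := by
  refine Real.sInf_nonneg ?_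
  rintro r ⟨A, -, -, rfl⟩
  exact Gr.cut_div_min_nonneg A

theorem cheeger_mul_min_le_cut (A : Finset (Fin n)) :
    Gr.cheeger * min (∑ u ∈ A, Gr.vol u) (∑ v ∈ Aᶜ, Gr.vol v) ≤ Gr.cut A := by
  rcases (le_min (sum_nonneg fun _ _ => Gr.vol_nonneg _)
    (sum_nonneg fun _ _ => Gr.vol_nonneg _) :
      0 ≤ min (∑ u ∈ A, Gr.vol u) (∑ v ∈ Aᶜ, Gr.vol v)).eq_or_lt with h | h
  · rw [← h, mul_zero]
    exact Gr.cut_nonneg A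
  · rw [← le_div_iff₀ h]
    refine csInf_le ⟨0, ?_⟩ ⟨A, ?_, ?_, rfl⟩
    · rintro r ⟨B, -, -, rfl⟩
      exact Gr.cut_div_min_nonneg B
    · rw [nonempty_iff_ne_empty]
      rintro rfl
      simp at h
    · rintro rfl
      simp at h

theorem fracH_nonneg {ρ : Fin n → ℝ} (hρ : IsFracPartition ρ) : 0 ≤ Gr.fracH ρ := by
  have h (u) : 0 ≤ 1 - ρ u := sub_nonneg.2 (hρ u).2
  refine div_nonneg (sum_nonneg fun u _ => sum_nonneg fun v _ =>
    mul_nonneg (mul_nonneg (hρ u).1 (h v)) (Gr.nonneg u v)) (le_min ?_ ?_)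
  · exact sum_nonneg fun u _ => mul_nonneg (hρ u).1 (Gr.vol_nonneg u)
  · exact sum_nonneg fun u _ => mul_nonneg (h u) (Gr.vol_nonneg u)

theorem fracCheeger_nonneg : 0 ≤ Gr.fracCheeger := by
  refine Real.sInf_nonneg ?_
  rintro r ⟨ρ, hρ, -, -, rfl⟩
  exact Gr.fracH_nonneg hρ

theorem fracH_one_sub (ρ : Fin n → ℝ) : Gr.fracH (fun u => 1 - ρ u) = Gr.fracH ρ := by
  unfold fracH
  simp_rw [sub_sub_cancel]
  rw [min_comm, sum_comm]
  congr 1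
  exact sum_congr rfl fun u _ => sum_congr rfl fun v _ => by rw [Gr.symm u v]; ring

/-- The expected weight of the cut given by the random set is its fractional counterpart. -/
theorem sum_bernoulliWeight_cut (hloop : Gr.Loopless) (ρ : Fin n → ℝ) :
    ∑ A, bernoulliWeight ρ A * Gr.cut A = ∑ u, ∑ v, ρ u * (1 - ρ v) * Gr.w u v := by
  have hcut (A : Finset (Fin n)) :
      Gr.cut A = ∑ u ∈ A, Gr.vol u - ∑ u ∈ A, ∑ v ∈ A, Gr.w u v := by
    rw [cut, ← sum_sub_distrib]
    refine sum_congr rfl fun u _ => ?_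
    rw [vol, ← sum_add_sum_compl A]
    ring
  simp_rw [hcut, mul_sub, sum_sub_distrib]
  rw [sum_bernoulliWeight_linear, sum_bernoulliWeight_quadratic, ← sum_sub_distrib]
  refine sum_congr rfl fun u _ => ?_
  rw [vol, mul_sum, ← sum_sub_distrib]
  refine sum_congr rfl fun v _ => ?_
  split_ifs with huv
  · subst huv
    simp [hloop u]
  · ring

theorem le_fracH_of_two_mul_le (hloop : Gr.Loopless) {κ ε : ℝ} {ρ : Fin n → ℝ}
    (hρ : IsFracPartition ρ) (hpos : 0 < ∑ u, ρ u * Gr.vol u) (hT : 0 < ∑ u, Gr.vol u)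
    (hκ : 0 ≤ κ) (hM : ∀ u, Gr.vol u ≤ κ * ∑ u, Gr.vol u)
    (hε0 : 0 < ε) (hε1 : ε < 1) (hκε : 2 * κ < ε ^ 2)
    (hhalf : 2 * ∑ u, ρ u * Gr.vol u ≤ ∑ u, Gr.vol u) :
    (1 - 2 * κ / ε ^ 2) * (1 - ε) * Gr.cheeger ≤ Gr.fracH ρ := by
  have hmin : min (∑ u, ρ u * Gr.vol u) (∑ v, (1 - ρ v) * Gr.vol v) = ∑ u, ρ u * Gr.vol u := by
    refine min_eq_left ?_
    simp_rw [sub_mul, one_mul, sum_sub_distrib]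
    linarith
  rw [fracH, hmin, le_div_iff₀ hpos, ← Gr.sum_bernoulliWeight_cut hloop]
  calc _ = Gr.cheeger * ((1 - 2 * κ / ε ^ 2) * (1 - ε) * ∑ u, ρ u * Gr.vol u) := by ring
    _ ≤ Gr.cheeger * ∑ A, bernoulliWeight ρ A * min (∑ u ∈ A, Gr.vol u) (∑ u ∈ Aᶜ, Gr.vol u) :=
      mul_le_mul_of_nonneg_left
        (le_sum_bernoulliWeight_min hρ Gr.vol_nonneg hT hκ hM hε0 hε1 hκε hhalf)
        Gr.cheeger_nonneg
    _ ≤ _ := by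
      rw [mul_sum]
      refine sum_le_sum fun A _ => ?_
      rw [mul_left_comm]
      exact mul_le_mul_of_nonneg_left (Gr.cheeger_mul_min_le_cut A) (bernoulliWeight_nonneg hρ A)

theorem vol_pos (hconn : Gr.Connected) (hT : 0 < ∑ u, Gr.vol u) (u : Fin n) :
    0 < Gr.vol u := by
  by_cases h : ({u} : Finset (Fin n)) = univ
  · rwa [← h, sum_singleton] at hT
  · refine (hconn {u} (singleton_nonempty u) h).trans_le ?_
    rw [cut, sum_singleton]
    exact sum_le_sum_of_subset_of_nonneg (subset_univ _) fun v _ _ => Gr.nonneg u v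

theorem cheeger_eq_zero_of_vol (h : ∀ u, Gr.vol u = 0) : Gr.cheeger = 0 := by
  refine le_antisymm (Real.sInf_nonpos ?_) Gr.cheeger_nonneg
  rintro r ⟨A, -, -, rfl⟩
  simp [h]

end WGraph

/-- **Comparison of the Cheeger and fractional Cheeger constants.**
Let `G` be a connected loopless weighted graph on `n ≥ 1` vertices, and let
`γ = vol_max / vol_min`.  Then for every `0 < ε < 1`,
`h̃_G ≥ (1 − 2γ/(ε²·n)) · (1 − ε) · h_G`. -/
theorem fracCheeger_ge {n : ℕ} (Gr : WGraph n) (hn : 0 < n)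
    (hconn : Gr.Connected) (hloop : Gr.Loopless)
    (ε : ℝ) (hε0 : 0 < ε) (hε1 : ε < 1) :
    (1 - 2 * (sSup (Set.range Gr.vol) / sInf (Set.range Gr.vol)) / (ε ^ 2 * n)) *
        (1 - ε) * Gr.cheeger ≤ Gr.fracCheeger := by
  rcases (sum_nonneg fun u _ => Gr.vol_nonneg u : 0 ≤ ∑ u, Gr.vol u).eq_or_lt with hT | hT
  · have h := (sum_eq_zero_iff_of_nonneg fun u _ => Gr.vol_nonneg u).1 hT.symm
    rw [Gr.cheeger_eq_zero_of_vol fun u => h u (mem_univ u), mul_zero]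
    exact Gr.fracCheeger_nonneg
  have : Nonempty (Fin n) := ⟨⟨0, hn⟩⟩
  have hn' : (0 : ℝ) < n := Nat.cast_pos.2 hn
  have hfin := Set.finite_range Gr.vol
  obtain ⟨u₀, hu₀⟩ := (Set.range_nonempty Gr.vol).csInf_mem hfin
  have hmin (u) : sInf (Set.range Gr.vol) ≤ Gr.vol u := csInf_le hfin.bddBelow ⟨u, rfl⟩
  have hmax (u) : Gr.vol u ≤ sSup (Set.range Gr.vol) := le_csSup hfin.bddAbove ⟨u, rfl⟩
  have hmin0 : 0 < sInf (Set.range Gr.vol) := hu₀ ▸ Gr.vol_pos hconn hT u₀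
  have hmax0 : 0 ≤ sSup (Set.range Gr.vol) := (Gr.vol_nonneg u₀).trans (hmax u₀)
  generalize sInf (Set.range Gr.vol) = a at *
  generalize sSup (Set.range Gr.vol) = b at *
  obtain ⟨κ, hκ⟩ : ∃ κ : ℝ, κ = b / a / n := ⟨_, rfl⟩
  have hκ0 : 0 ≤ κ := by rw [hκ]; positivity
  have hκ_eq : 2 * (b / a) / (ε ^ 2 * n) = 2 * κ / ε ^ 2 := by
    rw [hκ]; field_simp
  have hM (u) : Gr.vol u ≤ κ * ∑ u, Gr.vol u := by
    have hsum : n * a ≤ ∑ u, Gr.vol u := by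
      simpa using card_nsmul_le_sum univ Gr.vol a fun u _ => hmin u
    calc Gr.vol u ≤ b := hmax u
      _ = κ * (n * a) := by rw [hκ]; field_simp
      _ ≤ _ := mul_le_mul_of_nonneg_left hsum hκ0
  rw [hκ_eq]
  rcases le_or_gt (ε ^ 2) (2 * κ) with hκε | hκε
  · have h : 1 ≤ 2 * κ / ε ^ 2 := (one_le_div (by positivity)).2 hκε
    refine le_trans ?_ Gr.fracCheeger_nonneg
    exact mul_nonpos_of_nonpos_of_nonneg
      (mul_nonpos_of_nonpos_of_nonneg (by linarith) (by linarith)) Gr.cheeger_nonneg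
  refine le_csInf ⟨_, fun _ => 1 / 2, fun _ => by norm_num, ?_, ?_, rfl⟩ ?_
  · rw [← mul_sum]; positivity
  · rw [← mul_sum]; linarith
  rintro r ⟨ρ, hρ, h₁, h₂, rfl⟩
  have hsplit : ∑ v, (1 - ρ v) * Gr.vol v = ∑ v, Gr.vol v - ∑ v, ρ v * Gr.vol v := by
    simp_rw [sub_mul, one_mul, sum_sub_distrib]
  rcases le_total (2 * ∑ u, ρ u * Gr.vol u) (∑ u, Gr.vol u) with hhalf | hhalf
  · exact Gr.le_fracH_of_two_mul_le hloop hρ h₁ hT hκ0 hM hε0 hε1 hκε hhalf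
  · rw [← Gr.fracH_one_sub]
    refine Gr.le_fracH_of_two_mul_le hloop (fun u => ?_) h₂ hT hκ0 hM hε0 hε1 hκε ?_
    · exact ⟨sub_nonneg.2 (hρ u).2, sub_le_self 1 (hρ u).1⟩
    · linarith
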